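/- Let (G,u) be a maximum flow instance with |E| = m ≥ 1. Then: (a) for every directed path P from s to t in G, min_{e∈P} u_e ≤ ν(G,u); and (b) for every feasible flow f with val(f) > 0 there exists a directed path P from s to t in G with min_{e∈P} u_e ≥ val(f)/m. In particular, if ν(G,u) is finite, positive and attained by some feasible flow, then the maximum over directed s–t paths P of min_{e∈P} u_e lies between ν(G,u)/m and ν(G,u). -/

import Mathlib

open scoped ENNReal Classical

noncomputable section

/-- A maximum flow instance: a finite directed graph (parallel arcs allowed, no
self-loops) with distinct source `s` and sink `t`, a fixed-point-free reversal
involution on arcs, and capacities in `[0,∞]`. -/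
structure FlowInstance (V E : Type) [Fintype V] [Fintype E] [DecidableEq V] where
  tail : E → V
  head : E → V
  s : V
  t : V
  s_ne_t : s ≠ t
  rev : E → E
  rev_rev : ∀ e, rev (rev e) = e
  rev_ne : ∀ e, rev e ≠ e
  tail_rev : ∀ e, tail (rev e) = head e
  head_rev : ∀ e, head (rev e) = tail e
  no_loop : ∀ e, tail e ≠ head e
  u : E → ℝ≥0∞

namespace FlowInstance

variable {V E : Type} [Fintype V] [Fintype E] [DecidableEq V]

/-- The excess of a node: total inflow minus total outflow. -/
def excess (I : FlowInstance V E) (f : E → ℝ) (i : V) : ℝ :=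
  ∑ e ∈ Finset.univ.filter (fun e => I.head e = i), f e -
    ∑ e ∈ Finset.univ.filter (fun e => I.tail e = i), f e

/-- A feasible flow: nonnegative, within capacities, and conserving at every
node other than `s` and `t`. -/
def Feasible (I : FlowInstance V E) (f : E → ℝ) : Prop :=
  (∀ e, 0 ≤ f e) ∧ (∀ e, ENNReal.ofReal (f e) ≤ I.u e) ∧
    ∀ i, i ≠ I.s → i ≠ I.t → I.excess f i = 0

/-- The value of a flow. -/
def val (I : FlowInstance V E) (f : E → ℝ) : ℝ := -I.excess f I.s

/-- The set of values of feasible flows. -/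
def flowValues (I : FlowInstance V E) : Set ℝ := {x | ∃ f, I.Feasible f ∧ I.val f = x}

/-- The maximum flow value `ν(G,u)` (as a real supremum). -/
def maxFlowVal (I : FlowInstance V E) : ℝ := sSup I.flowValues

/-- The instance is bounded if `ν(G,u) < ∞`. -/
def Bounded (I : FlowInstance V E) : Prop := BddAbove I.flowValues

/-- Residual capacities `u^f_e = u_e - f_e + f_{rev e}` of a flow. -/
def residual (I : FlowInstance V E) (f : E → ℝ) : E → ℝ≥0∞ :=
  fun e => I.u e - ENNReal.ofReal (f e) + ENNReal.ofReal (f (I.rev e))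

/-- The instance on the same graph with capacities replaced by `u'`. -/
def withCapacity (I : FlowInstance V E) (u' : E → ℝ≥0∞) : FlowInstance V E :=
  { I with u := u' }

/-- An `s`–`t` cut. -/
def IsCut (I : FlowInstance V E) (S : Finset V) : Prop := I.s ∈ S ∧ I.t ∉ S

/-- The capacity `u(S, V∖S)` of a cut. -/
def cutCap (I : FlowInstance V E) (S : Finset V) : ℝ≥0∞ :=
  ∑ e ∈ Finset.univ.filter (fun e => I.tail e ∈ S ∧ I.head e ∉ S), I.u e

/-- The total residual capacity `u^f(S, V∖S)` of a cut. -/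
def resCutCap (I : FlowInstance V E) (f : E → ℝ) (S : Finset V) : ℝ≥0∞ :=
  ∑ e ∈ Finset.univ.filter (fun e => I.tail e ∈ S ∧ I.head e ∉ S), I.residual f e

/-- A directed path from `x` to `y` through pairwise distinct nodes using only
arcs from `A`. -/
def IsDiPath (I : FlowInstance V E) (A : Set E) (x y : V) : Prop :=
  ∃ (k : ℕ) (v : Fin (k + 1) → V) (es : Fin k → E),
    v 0 = x ∧ v (Fin.last k) = y ∧ Function.Injective v ∧
    ∀ i : Fin k, es i ∈ A ∧ I.tail (es i) = v i.castSucc ∧ I.head (es i) = v i.succ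

/-- `A` contains a directed cycle: a head-to-tail sequence of arcs of `A` through
pairwise distinct nodes returning to its starting node. -/
def HasDiCycle (I : FlowInstance V E) (A : Set E) : Prop :=
  ∃ (k : ℕ) (v : Fin (k + 1) → V) (es : Fin (k + 1) → E),
    Function.Injective v ∧
    ∀ i : Fin (k + 1), es i ∈ A ∧ I.tail (es i) = v i ∧ I.head (es i) = v (i + 1)

/-- The constant `Γ = 4 n²` where `n = |V|`. -/
def Gamma (I : FlowInstance V E) : ℝ := 4 * (Fintype.card V : ℝ) ^ 2

end FlowInstance

/-- `I'` extends `I`: same node set, same `s` and `t`, the arc set of `I'` contains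
that of `I` (via the injection `ι`), with the same endpoints, capacities and
reversal involution on the arcs of `I`. -/
def IsExtension {V E E' : Type} [Fintype V] [Fintype E] [Fintype E'] [DecidableEq V]
    (I : FlowInstance V E) (I' : FlowInstance V E') (ι : E → E') : Prop :=
  Function.Injective ι ∧ I'.s = I.s ∧ I'.t = I.t ∧
    (∀ e, I'.tail (ι e) = I.tail e) ∧ (∀ e, I'.head (ι e) = I.head e) ∧
    (∀ e, I'.rev (ι e) = ι (I.rev e)) ∧ (∀ e, I'.u (ι e) = I.u e)

/-- The maximum flow value `ν(G,u)` as an extended nonnegative real. -/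
def FlowInstance.maxFlowValE {V E : Type} [Fintype V] [Fintype E] [DecidableEq V]
    (I : FlowInstance V E) : ℝ≥0∞ :=
  ⨆ (f : E → ℝ) (_ : I.Feasible f), ENNReal.ofReal (I.val f)

/-- `v`, `es` form a directed path from `s` to `t` through pairwise distinct
nodes. -/
def FlowInstance.IsPathSeq {V E : Type} [Fintype V] [Fintype E] [DecidableEq V]
    (I : FlowInstance V E) {k : ℕ} (v : Fin (k + 1) → V) (es : Fin k → E) : Prop :=
  v 0 = I.s ∧ v (Fin.last k) = I.t ∧ Function.Injective v ∧
    ∀ i : Fin k, I.tail (es i) = v i.castSucc ∧ I.head (es i) = v i.succ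

namespace FlowInstance

/-- The flow sending `c` units along each arc of the sequence `es`. -/
def pathFlow {E : Type} {k : ℕ} (es : Fin k → E) (c : ℝ) (e : E) : ℝ :=
  ∑ i, if es i = e then c else 0

theorem sum_filter_pathFlow {V E : Type} [Fintype E] [DecidableEq V] {k : ℕ}
    (es : Fin k → E) (c : ℝ) (g : E → V) (x : V) :
    ∑ e ∈ Finset.univ.filter (fun e => g e = x), pathFlow es c e =
      ∑ i, if g (es i) = x then c else 0 := by
  unfold pathFlow
  rw [Finset.sum_comm]
  refine Finset.sum_congr rfl fun i _ => ?_
  rw [Finset.sum_ite_eq]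
  simp

variable {V E : Type} [Fintype V] [Fintype E] [DecidableEq V]

theorem IsPathSeq.injective {I : FlowInstance V E} {k : ℕ} {v : Fin (k + 1) → V}
    {es : Fin k → E} (h : I.IsPathSeq v es) : Function.Injective es := by
  obtain ⟨-, -, hv, hes⟩ := h
  intro i j hij
  apply Fin.castSucc_injective k
  apply hv
  rw [← (hes i).1, ← (hes j).1, hij]

theorem IsPathSeq.excess_pathFlow {I : FlowInstance V E} {k : ℕ} {v : Fin (k + 1) → V}
    {es : Fin k → E} (h : I.IsPathSeq v es) (c : ℝ) (x : V) :
    I.excess (pathFlow es c) x = (if I.t = x then c else 0) - if I.s = x then c else 0 := by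
  obtain ⟨h0, hl, -, hes⟩ := h
  unfold excess
  rw [sum_filter_pathFlow, sum_filter_pathFlow]
  simp only [fun i => (hes i).1, fun i => (hes i).2]
  have h1 := Fin.sum_univ_succ fun i => if v i = x then c else 0
  have h2 := Fin.sum_univ_castSucc fun i => if v i = x then c else 0
  simp only [h0, hl] at h1 h2
  linarith

theorem IsPathSeq.feasible_pathFlow {I : FlowInstance V E} {k : ℕ} {v : Fin (k + 1) → V}
    {es : Fin k → E} (h : I.IsPathSeq v es) {c : ℝ} (hc : 0 ≤ c)
    (hu : ∀ i, ENNReal.ofReal c ≤ I.u (es i)) : I.Feasible (pathFlow es c) := by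
  refine ⟨fun e => Finset.sum_nonneg fun i _ => by split_ifs <;> simp [hc], fun e => ?_,
    fun x hs ht => ?_⟩
  · by_cases he : ∃ j, es j = e
    · obtain ⟨j, rfl⟩ := he
      simpa [pathFlow, h.injective.eq_iff] using hu j
    · push Not at he
      simp [pathFlow, he]
  · rw [h.excess_pathFlow, if_neg hs.symm, if_neg ht.symm, sub_zero]

theorem IsPathSeq.iInf_le_maxFlowValE {I : FlowInstance V E} {k : ℕ} {v : Fin (k + 1) → V}
    {es : Fin k → E} (h : I.IsPathSeq v es) : (⨅ i, I.u (es i)) ≤ I.maxFlowValE := by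
  refine ENNReal.le_of_forall_nnreal_lt fun c hc => ?_
  have hf : I.Feasible (pathFlow es c) := h.feasible_pathFlow c.2 fun i => by
    rw [ENNReal.ofReal_coe_nnreal]
    exact hc.le.trans (iInf_le _ i)
  have hv : I.val (pathFlow es c) = c := by
    simp [val, h.excess_pathFlow, I.s_ne_t.symm]
  calc (c : ℝ≥0∞) = ENNReal.ofReal (I.val (pathFlow es c)) := by simp [hv]
    _ ≤ I.maxFlowValE := le_iSup₂ (f := fun f (_ : I.Feasible f) => ENNReal.ofReal (I.val f)) _ hf

theorem IsDiPath.refl (I : FlowInstance V E) (A : Set E) (x : V) : I.IsDiPath A x x :=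
  ⟨0, fun _ => x, Fin.elim0, rfl, rfl, fun _ _ _ => Subsingleton.elim (α := Fin 1) _ _,
    fun i => i.elim0⟩

theorem IsDiPath.step {I : FlowInstance V E} {A : Set E} {x : V} {e : E}
    (h : I.IsDiPath A x (I.tail e)) (he : e ∈ A) : I.IsDiPath A x (I.head e) := by
  obtain ⟨k, v, es, h0, hl, hv, hes⟩ := h
  by_cases hy : ∃ j, v j = I.head e
  · obtain ⟨j, hj⟩ := hy
    refine ⟨j, fun i => v (Fin.castLE j.2 i), fun i => es (Fin.castLE (Nat.le_of_lt_succ j.2) i),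
      h0, hj, hv.comp (Fin.castLE_injective _), fun i => hes _⟩
  · refine ⟨k + 1, Fin.snoc (α := fun _ => V) v (I.head e), Fin.snoc (α := fun _ => E) es e,
      ?_, by simp, ?_, fun i => ?_⟩
    · rw [← Fin.castSucc_zero, Fin.snoc_castSucc, h0]
    · exact Fin.snoc_injective_iff.2 ⟨hv, hy⟩
    · induction i using Fin.lastCases with
      | last => simp [he, hl]
      | cast i => rw [Fin.succ_castSucc]; simpa only [Fin.snoc_castSucc] using hes i

theorem sum_excess (I : FlowInstance V E) (f : E → ℝ) (S : Finset V) :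
    ∑ x ∈ S, I.excess f x =
      ∑ e, ((if I.head e ∈ S then f e else 0) - if I.tail e ∈ S then f e else 0) := by
  have key (g : E → V) : ∑ x ∈ S, ∑ e ∈ Finset.univ.filter (fun e => g e = x), f e =
      ∑ e, if g e ∈ S then f e else 0 := by
    simp only [Finset.sum_filter]
    rw [Finset.sum_comm]
    exact Finset.sum_congr rfl fun e _ => Finset.sum_ite_eq S (g e) fun _ => f e
  simp only [excess, Finset.sum_sub_distrib, key]

theorem Feasible.sum_excess_of_isCut {I : FlowInstance V E} {f : E → ℝ} (hf : I.Feasible f)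
    {S : Finset V} (hS : I.IsCut S) : ∑ x ∈ S, I.excess f x = -I.val f := by
  rw [val, neg_neg]
  refine Finset.sum_eq_single_of_mem _ hS.1 fun x hx hs => hf.2.2 x hs ?_
  rintro rfl
  exact hS.2 hx

theorem Feasible.val_le_cut {I : FlowInstance V E} {f : E → ℝ} (hf : I.Feasible f)
    {S : Finset V} (hS : I.IsCut S) :
    I.val f ≤ ∑ e, if I.tail e ∈ S ∧ I.head e ∉ S then f e else 0 := by
  have h := hf.sum_excess_of_isCut hS
  rw [sum_excess] at h
  rw [← neg_neg (I.val f), ← h, ← Finset.sum_neg_distrib]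
  refine Finset.sum_le_sum fun e _ => ?_
  have := hf.1 e
  by_cases h1 : I.head e ∈ S <;> by_cases h2 : I.tail e ∈ S <;> simp [h1, h2, this]

theorem Feasible.exists_isPathSeq {I : FlowInstance V E} {f : E → ℝ} (hf : I.Feasible f)
    (hval : 0 < I.val f) :
    ∃ (k : ℕ) (v : Fin (k + 1) → V) (es : Fin k → E), I.IsPathSeq v es ∧
      ENNReal.ofReal (I.val f / (Fintype.card E : ℝ)) ≤ ⨅ i, I.u (es i) := by
  set c := I.val f / (Fintype.card E : ℝ)
  suffices h : I.IsDiPath {e | c ≤ f e} I.s I.t by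
    obtain ⟨k, v, es, h0, hl, hv, hes⟩ := h
    exact ⟨k, v, es, ⟨h0, hl, hv, fun i => (hes i).2⟩, le_iInf fun i =>
      (ENNReal.ofReal_le_ofReal (hes i).1).trans (hf.2.1 _)⟩
  by_contra ht
  let S : Finset V := Finset.univ.filter fun x => I.IsDiPath {e | c ≤ f e} I.s x
  have hS : I.IsCut S := ⟨by simp [S, IsDiPath.refl], by simp [S, ht]⟩
  have hcut := hf.val_le_cut hS
  have hne : Nonempty E := by
    by_contra hE
    rw [not_nonempty_iff] at hE
    simp at hcut
    linarith
  have hcard : (0 : ℝ) < Fintype.card E := by exact_mod_cast Fintype.card_pos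
  have hlt : ∑ e, (if I.tail e ∈ S ∧ I.head e ∉ S then f e else 0) < ∑ _e : E, c := by
    refine Finset.sum_lt_sum_of_nonempty Finset.univ_nonempty fun e _ => ?_
    split_ifs with h
    · by_contra! hce
      simp only [S, Finset.mem_filter, Finset.mem_univ, true_and] at h
      exact h.2 (h.1.step hce)
    · exact div_pos hval hcard
  have hsum : ∑ _e : E, c = I.val f := by
    simp [c, mul_div_cancel₀ _ hcard.ne']
  linarith

end FlowInstance

/-- Bottleneck capacities of `s`–`t` paths versus the maximum flow value:
(a) every `s`–`t` path has bottleneck capacity at most `ν(G,u)`;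
(b) every feasible flow of positive value yields an `s`–`t` path of bottleneck
capacity at least `val(f)/m`; and consequently if `ν(G,u)` is finite, positive
and attained then the maximum bottleneck capacity of an `s`–`t` path lies
between `ν(G,u)/m` and `ν(G,u)`. -/
theorem bottleneck_path_bounds
    {V E : Type} [Fintype V] [Fintype E] [DecidableEq V]
    (I : FlowInstance V E) (hm : 1 ≤ Fintype.card E) :
    (∀ (k : ℕ) (v : Fin (k + 1) → V) (es : Fin k → E), I.IsPathSeq v es →
      (⨅ i, I.u (es i)) ≤ I.maxFlowValE) ∧
    (∀ f : E → ℝ, I.Feasible f → 0 < I.val f →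
      ∃ (k : ℕ) (v : Fin (k + 1) → V) (es : Fin k → E), I.IsPathSeq v es ∧
        ENNReal.ofReal (I.val f / (Fintype.card E : ℝ)) ≤ ⨅ i, I.u (es i)) ∧
    (I.maxFlowValE ≠ ⊤ → 0 < I.maxFlowValE →
      (∃ f : E → ℝ, I.Feasible f ∧ ENNReal.ofReal (I.val f) = I.maxFlowValE) →
      (∃ (k : ℕ) (v : Fin (k + 1) → V) (es : Fin k → E), I.IsPathSeq v es ∧
        ENNReal.ofReal (I.maxFlowValE.toReal / (Fintype.card E : ℝ)) ≤ ⨅ i, I.u (es i)) ∧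
      ∀ (k : ℕ) (v : Fin (k + 1) → V) (es : Fin k → E), I.IsPathSeq v es →
        (⨅ i, I.u (es i)) ≤ I.maxFlowValE) := by
  refine ⟨fun k v es h => h.iInf_le_maxFlowValE, fun f hf hval => hf.exists_isPathSeq hval,
    fun _ hpos hatt => ⟨?_, fun k v es h => h.iInf_le_maxFlowValE⟩⟩
  obtain ⟨f, hf, hval⟩ := hatt
  rw [← hval, ENNReal.ofReal_pos] at hpos
  rw [← hval, ENNReal.toReal_ofReal hpos.le]
  exact hf.exists_isPathSeq hpos
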